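/- There exists an integer n⋆(ε) such that R_n ≥ (1−ε) n^{(1+ε)/3} for all integers n ≥ n⋆(ε). -/

import Mathlib

noncomputable section

namespace CubePacking

/-- The side lengths `ℓ_k := k^{−(1+ε)/3}`. -/
def sideLen (ε : ℝ) (k : ℕ) : ℝ := (k : ℝ) ^ (-(1 + ε) / 3)

/-- `L_n^m := ∑_{k=n}^m ℓ_k`, the length needed to put the cubes `n,…,m` in a row. -/
def L (ε : ℝ) (n m : ℕ) : ℝ := ∑ k ∈ Finset.Icc n m, sideLen ε k

/-- `M_n := max{m ≥ n : L_n^m ≤ 1} − n + 1`, the number of cubes, starting from the `n`-th,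
fitting in a row of length `1`.  (The maximum exists for `n ≥ 1` since `ℓ_n ≤ 1` and
`L_n^m → ∞` as `m → ∞`; it is realized here by `sSup`, which coincides with the maximum
of a nonempty bounded-above set of naturals.) -/
def M (ε : ℝ) (n : ℕ) : ℕ := sSup {m : ℕ | n ≤ m ∧ L ε n m ≤ 1} - n + 1

/-- The index `B^n_r` of the first cube of the `r`-th row when rows are started at the `n`-th
cube: `B^n_1 := n` and `B^n_{r+1} := B^n_r + M_{B^n_r}` for `r ≥ 1`. -/
def B (ε : ℝ) (n : ℕ) : ℕ → ℕ
  | 0 => n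
  | 1 => n
  | r + 2 => B ε n (r + 1) + M ε (B ε n (r + 1))

/-- `W_n^R := ∑_{r=1}^R (B^n_r)^{−(1+ε)/3}`, the width occupied by `R` rows starting at the
`n`-th cube. -/
def W (ε : ℝ) (n R : ℕ) : ℝ := ∑ r ∈ Finset.Icc 1 R, (B ε n r : ℝ) ^ (-(1 + ε) / 3)

/-- `R_n := max{R ≥ 1 : W_n^R ≤ 1}`, the number of rows fitting in the unit square starting
from the `n`-th cube.  (Again the maximum is realized by `sSup`.) -/
def Rn (ε : ℝ) (n : ℕ) : ℕ := sSup {R : ℕ | 1 ≤ R ∧ W ε n R ≤ 1}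

/-- `N_n := B^n_{R_n+1} − n + 1`, the number of cubes in those rows. -/
def N (ε : ℝ) (n : ℕ) : ℕ := B ε n (Rn ε n + 1) - n + 1

/-- The index `S_l` of the cube starting the `l`-th vertical layer:
`S_1 := 1` and `S_{l+1} := S_l + N_{S_l}` for `l ≥ 1`. -/
def S (ε : ℝ) : ℕ → ℕ
  | 0 => 1
  | 1 => 1
  | l + 2 => S ε (l + 1) + N ε (S ε (l + 1))

/-- The height `H_l := S_l^{−(1+ε)/3}` of the `l`-th layer. -/
def H (ε : ℝ) (l : ℕ) : ℝ := (S ε l : ℝ) ^ (-(1 + ε) / 3)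

end CubePacking

namespace CubePacking

lemma inv_sqrt_le_sideLen {ε : ℝ} (hε : ε < 1 / 2) {k : ℕ} (hk : 1 ≤ k) :
    (√(k : ℝ))⁻¹ ≤ (k : ℝ) ^ (-(1 + ε) / 3) := by
  rw [Real.sqrt_eq_rpow, ← Real.rpow_neg (Nat.cast_nonneg k)]
  exact Real.rpow_le_rpow_of_exponent_le (by exact_mod_cast hk) (by linarith)

lemma rpow_le_rpow_of_index_le {ε : ℝ} (hε0 : 0 < ε) {k j : ℕ} (hk : 1 ≤ k) (hkj : k ≤ j) :
    (j : ℝ) ^ (-(1 + ε) / 3) ≤ (k : ℝ) ^ (-(1 + ε) / 3) :=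
  Real.rpow_le_rpow_of_nonpos (by exact_mod_cast hk) (by exact_mod_cast hkj) (by linarith)

lemma M_le_succ_of_le_sq {ε : ℝ} (hε0 : 0 < ε) (hε : ε < 1 / 2) {m t : ℕ} (hm : 1 ≤ m)
    (hmt : m ≤ t ^ 2) : M ε m ≤ t + 1 := by
  have hsup : sSup {j : ℕ | m ≤ j ∧ L ε m j ≤ 1} ≤ m + t := by
    refine csSup_le' ?_
    rintro j ⟨hmj, hL⟩
    have hj : 1 ≤ j := hm.trans hmj
    have hj0 : (0 : ℝ) < √(j : ℝ) := Real.sqrt_pos.2 (by exact_mod_cast hj)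
    have hcard : ((j + 1 - m : ℕ) : ℝ) * (√(j : ℝ))⁻¹ ≤ L ε m j := by
      have h := Finset.card_nsmul_le_sum (Finset.Icc m j) (sideLen ε) ((√(j : ℝ))⁻¹)
        (fun k hk => (inv_sqrt_le_sideLen hε hj).trans
          (rpow_le_rpow_of_index_le hε0 (hm.trans (Finset.mem_Icc.1 hk).1) (Finset.mem_Icc.1 hk).2))
      simpa [L] using h
    have hle : ((j + 1 - m : ℕ) : ℝ) ≤ √(j : ℝ) := by
      have := hcard.trans hL
      rwa [← div_eq_mul_inv, div_le_one hj0] at this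
    have hsq : (j + 1 - m) ^ 2 ≤ j := by
      have := (Real.le_sqrt (Nat.cast_nonneg _) (Nat.cast_nonneg _)).1 hle
      exact_mod_cast this
    obtain ⟨d, rfl⟩ := Nat.exists_eq_add_of_le hmj
    have hd : m + d + 1 - m = d + 1 := by omega
    rw [hd] at hsq
    by_contra! hlt
    have : t + 1 ≤ d := by omega
    nlinarith
  unfold M
  omega

lemma le_B (ε : ℝ) (n r : ℕ) : n ≤ B ε n r := by
  induction r with
  | zero => exact le_rfl
  | succ r ih =>
    cases r with
    | zero => exact le_rfl
    | succ r => exact ih.trans (Nat.le_add_right _ _)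

lemma B_le_sq {ε : ℝ} (hε0 : 0 < ε) (hε : ε < 1 / 2) {n : ℕ} (hn : 1 ≤ n) (r : ℕ) :
    B ε n r ≤ (n + r) ^ 2 := by
  induction r with
  | zero => simp only [B]; nlinarith
  | succ r ih =>
    cases r with
    | zero => simp only [B]; nlinarith
    | succ r =>
      have h := M_le_succ_of_le_sq hε0 hε (hn.trans (le_B ε n (r + 1))) ih
      simp only [B]
      nlinarith

lemma not_summable_B_rpow {ε : ℝ} (hε0 : 0 < ε) (hε : ε < 1 / 2) {n : ℕ} (hn : 1 ≤ n) :
    ¬ Summable fun r : ℕ => (B ε n r : ℝ) ^ (-(1 + ε) / 3) := by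
  intro hs
  refine Real.not_summable_natCast_inv ((summable_nat_add_iff n).1 (hs.of_nonneg_of_le ?_ ?_))
  · intro r
    positivity
  · intro r
    have hB : 1 ≤ B ε n r := hn.trans (le_B ε n r)
    refine le_trans ?_ (inv_sqrt_le_sideLen hε hB)
    have hB0 : (0 : ℝ) < √(B ε n r : ℝ) := Real.sqrt_pos.2 (by exact_mod_cast hB)
    refine inv_anti₀ hB0 (Real.sqrt_le_iff.2 ⟨by positivity, ?_⟩)
    have := B_le_sq hε0 hε hn r
    rw [add_comm r n]
    exact_mod_cast this

lemma W_mono (ε : ℝ) (n : ℕ) : Monotone (W ε n) := fun _ _ h =>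
  Finset.sum_le_sum_of_subset_of_nonneg (Finset.Icc_subset_Icc_right h)
    fun _ _ _ => by positivity

lemma bddAbove_W_le_one {ε : ℝ} (hε0 : 0 < ε) (hε : ε < 1 / 2) {n : ℕ} (hn : 1 ≤ n) :
    BddAbove {R : ℕ | 1 ≤ R ∧ W ε n R ≤ 1} := by
  by_contra hb
  rw [not_bddAbove_iff] at hb
  refine not_summable_B_rpow hε0 hε hn ((summable_nat_add_iff 1).1
    (summable_of_sum_range_le (c := 1) (fun r => by positivity) fun R => ?_))
  obtain ⟨R', ⟨-, hR'⟩, hlt⟩ := hb R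
  refine le_trans (le_of_eq ?_) ((W_mono ε n hlt.le).trans hR')
  rw [W, Finset.range_eq_Ico,
    Finset.sum_Ico_add' (fun r : ℕ => (B ε n r : ℝ) ^ (-(1 + ε) / 3)) 0 R 1]
  rfl

lemma W_le_mul {ε : ℝ} (hε0 : 0 < ε) {n : ℕ} (hn : 1 ≤ n) (R : ℕ) :
    W ε n R ≤ R * (n : ℝ) ^ (-(1 + ε) / 3) := by
  have h := Finset.sum_le_card_nsmul (Finset.Icc 1 R)
    (fun r : ℕ => (B ε n r : ℝ) ^ (-(1 + ε) / 3)) ((n : ℝ) ^ (-(1 + ε) / 3))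
    (fun r _ => rpow_le_rpow_of_index_le hε0 hn (le_B ε n r))
  simpa [W] using h

lemma floor_rpow_le_Rn {ε : ℝ} (hε0 : 0 < ε) (hε : ε < 1 / 2) {n : ℕ} (hn : 1 ≤ n) :
    ⌊(n : ℝ) ^ ((1 + ε) / 3)⌋₊ ≤ Rn ε n := by
  have hn' : (1 : ℝ) ≤ n := by exact_mod_cast hn
  refine le_csSup (bddAbove_W_le_one hε0 hε hn) ⟨?_, (W_le_mul hε0 hn _).trans ?_⟩
  · exact Nat.le_floor (by simpa using Real.one_le_rpow hn' (by linarith))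
  · rw [neg_div, Real.rpow_neg (by positivity), ← div_eq_mul_inv]
    exact div_le_one_of_le₀ (Nat.floor_le (by positivity)) (by positivity)

end CubePacking

open CubePacking in
/-- Lower bound on `R_n`.
There exists `n⋆(ε)` such that `R_n ≥ (1−ε) n^{(1+ε)/3}` for all `n ≥ n⋆(ε)`. -/
theorem R_lower_bound (ε : ℝ) (hε0 : 0 < ε) (hε : ε < 1 / 2) :
    ∃ nst : ℕ, ∀ n : ℕ, nst ≤ n →
      (1 - ε) * (n : ℝ) ^ ((1 + ε) / 3) ≤ (Rn ε n : ℝ) := by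
  have hlim : Filter.Tendsto (fun n : ℕ => (n : ℝ) ^ ((1 + ε) / 3)) Filter.atTop Filter.atTop :=
    (tendsto_rpow_atTop (by linarith)).comp tendsto_natCast_atTop_atTop
  obtain ⟨nst, hnst⟩ := Filter.eventually_atTop.1
    ((hlim.eventually_ge_atTop ε⁻¹).and (Filter.eventually_ge_atTop 1))
  refine ⟨nst, fun n hn => ?_⟩
  obtain ⟨hlarge, hn1⟩ := hnst n hn
  have hfloor : ((⌊(n : ℝ) ^ ((1 + ε) / 3)⌋₊ : ℕ) : ℝ) ≤ Rn ε n := by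
    exact_mod_cast floor_rpow_le_Rn hε0 hε hn1
  have hlt := Nat.lt_floor_add_one ((n : ℝ) ^ ((1 + ε) / 3))
  have hone : 1 ≤ ε * (n : ℝ) ^ ((1 + ε) / 3) := (inv_le_iff_one_le_mul₀' hε0).1 hlarge
  linarith
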